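/- arXiv:1511.04720 — 2 statements merged into one kernel-verified Lean document; each statement's English description precedes it below -/
import Mathlib

section
/- Let p be a complex number with Re(p) > 1 and let N be a positive integer. Then (z + N^p) · ∑_{n=1}^∞ 1/(n^p + z) tends to 1 as z tends to -N^p through values z ≠ -n^p for all positive integers n. In other words, the function z ↦ ∑_{n=1}^∞ 1/(n^p + z) has a simple pole at z = -N^p with residue 1. -/
/-- For distinct positive integers `n` and `N`, `n^p` stays away from `N^p`. -/
theorem sep_aux (p : ℂ) (hp : 1 < p.re) (N n : ℕ+) (h : n ≠ N) :
    (1 - (((N : ℕ) : ℝ) / (((N : ℕ) : ℝ) + 1)) ^ p.re) * ((n : ℕ) : ℝ) ^ p.re ≤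
      ‖((n : ℕ) : ℂ) ^ p - ((N : ℕ) : ℂ) ^ p‖ := by
  have hs : 0 ≤ p.re := by linarith
  have hN : (0 : ℝ) < ((N : ℕ) : ℝ) := by exact_mod_cast N.pos
  have hn : (0 : ℝ) < ((n : ℕ) : ℝ) := by exact_mod_cast n.pos
  have e1 : ‖((n : ℕ) : ℂ) ^ p‖ = ((n : ℕ) : ℝ) ^ p.re := by
    exact Complex.norm_natCast_cpow_of_pos n.pos p
  have e2 : ‖((N : ℕ) : ℂ) ^ p‖ = ((N : ℕ) : ℝ) ^ p.re := by
    exact Complex.norm_natCast_cpow_of_pos N.pos p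
  have hr : 0 ≤ (((N : ℕ) : ℝ) / (((N : ℕ) : ℝ) + 1)) ^ p.re := by positivity
  have hr1 : (((N : ℕ) : ℝ) / (((N : ℕ) : ℝ) + 1)) ^ p.re ≤ 1 := by
    apply Real.rpow_le_one (by positivity) _ hs
    rw [div_le_one (by positivity)]; linarith
  rcases lt_or_gt_of_ne h with h | h
  · have h' : ((n : ℕ) : ℝ) + 1 ≤ ((N : ℕ) : ℝ) := by
      have : (n : ℕ) + 1 ≤ (N : ℕ) := h
      exact_mod_cast this
    have k : ((n : ℕ) : ℝ) ^ p.re ≤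
        (((N : ℕ) : ℝ) / (((N : ℕ) : ℝ) + 1)) ^ p.re * ((N : ℕ) : ℝ) ^ p.re := by
      rw [← Real.mul_rpow (by positivity) (by positivity)]
      apply Real.rpow_le_rpow hn.le _ hs
      rw [div_mul_eq_mul_div, le_div_iff₀ (by positivity)]
      nlinarith
    have k2 : ((n : ℕ) : ℝ) ^ p.re ≤ ((N : ℕ) : ℝ) ^ p.re :=
      Real.rpow_le_rpow hn.le (by linarith) hs
    have := norm_sub_norm_le (((N : ℕ) : ℂ) ^ p) (((n : ℕ) : ℂ) ^ p)
    rw [norm_sub_rev, e1, e2] at this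
    nlinarith
  · have h' : ((N : ℕ) : ℝ) + 1 ≤ ((n : ℕ) : ℝ) := by
      have : (N : ℕ) + 1 ≤ (n : ℕ) := h
      exact_mod_cast this
    have k : ((N : ℕ) : ℝ) ^ p.re ≤
        (((N : ℕ) : ℝ) / (((N : ℕ) : ℝ) + 1)) ^ p.re * ((n : ℕ) : ℝ) ^ p.re := by
      rw [← Real.mul_rpow (by positivity) (by positivity)]
      apply Real.rpow_le_rpow hN.le _ hs
      rw [div_mul_eq_mul_div, le_div_iff₀ (by positivity)]
      nlinarith
    have := norm_sub_norm_le (((n : ℕ) : ℂ) ^ p) (((N : ℕ) : ℂ) ^ p)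
    rw [e1, e2] at this
    nlinarith

/-- For `Re p > 1`, the function `z ↦ ∑_{n=1}^∞ 1/(n^p + z)` has a simple pole at
`z = -N^p` with residue `1`. -/
theorem statement1 (p : ℂ) (hp : 1 < p.re) (N : ℕ+) :
    Filter.Tendsto
      (fun z : ℂ => (z + ((N : ℕ) : ℂ) ^ p) * ∑' n : ℕ+, 1 / (((n : ℕ) : ℂ) ^ p + z))
      (nhdsWithin (-((N : ℕ) : ℂ) ^ p) {z : ℂ | ∀ n : ℕ+, z ≠ -((n : ℕ) : ℂ) ^ p})
      (nhds 1) := by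
  have hsep := sep_aux p hp N
  have hN : (0 : ℝ) < ((N : ℕ) : ℝ) := by exact_mod_cast N.pos
  obtain ⟨c, hc, hc0⟩ : ∃ c : ℝ, 1 - (((N : ℕ) : ℝ) / (((N : ℕ) : ℝ) + 1)) ^ p.re = c ∧ 0 < c := by
    refine ⟨_, rfl, ?_⟩
    rw [sub_pos]
    apply Real.rpow_lt_one (by positivity) _ (by linarith)
    rw [div_lt_one (by positivity)]; linarith
  rw [hc] at hsep
  have hpow : ∀ n : ℕ+, 1 ≤ ((n : ℕ) : ℝ) ^ p.re := fun n =>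
    Real.one_le_rpow (by exact_mod_cast n.pos) (by linarith)
  have hsum : Summable (fun n : ℕ+ => ((N : ℕ) : ℝ) ^ p.re * (1 / ((n : ℕ) : ℝ) ^ p.re)) := by
    apply Summable.mul_left
    exact (Real.summable_one_div_nat_rpow.2 hp).comp_injective PNat.coe_injective
  have h1 : (1 : ℂ) = ∑' n : ℕ+, (if n = N then (1 : ℂ) else 0) := by
    rw [tsum_ite_eq]
  have hnhds : nhds (1 : ℂ) = nhds (∑' n : ℕ+, (if n = N then (1 : ℂ) else 0)) :=
    congrArg nhds h1
  rw [hnhds]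
  simp_rw [← tsum_mul_left]
  refine tendsto_tsum_of_dominated_convergence hsum ?_ ?_
  · intro n
    by_cases h : n = N
    · subst h
      simp only [if_true]
      refine Filter.Tendsto.congr' ?_ tendsto_const_nhds
      filter_upwards [self_mem_nhdsWithin] with z hz
      have hz' : z + ((n : ℕ) : ℂ) ^ p ≠ 0 := fun h0 => hz n (eq_neg_of_add_eq_zero_left h0)
      rw [add_comm _ z, mul_one_div_cancel hz']
    · simp only [if_neg h]
      have hne : ((n : ℕ) : ℂ) ^ p + -((N : ℕ) : ℂ) ^ p ≠ 0 := by
        have := hsep n h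
        have h2 := hpow n
        rw [← sub_eq_add_neg, ← norm_pos_iff]
        nlinarith
      have hct : ContinuousAt (fun z : ℂ => (z + ((N : ℕ) : ℂ) ^ p) *
          (1 / (((n : ℕ) : ℂ) ^ p + z))) (-((N : ℕ) : ℂ) ^ p) := by
        apply ContinuousAt.mul (by fun_prop)
        exact ContinuousAt.div (by fun_prop) (by fun_prop) hne
      have := hct.tendsto
      simp only [neg_add_cancel, zero_mul] at this
      exact this.mono_left nhdsWithin_le_nhds
  · have hb : ∀ᶠ z in nhdsWithin (-((N : ℕ) : ℂ) ^ p)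
        {z : ℂ | ∀ n : ℕ+, z ≠ -((n : ℕ) : ℂ) ^ p}, ‖z + ((N : ℕ) : ℂ) ^ p‖ < c / 2 := by
      apply nhdsWithin_le_nhds
      filter_upwards [Metric.ball_mem_nhds (-((N : ℕ) : ℂ) ^ p) (half_pos hc0)] with z hz
      rwa [mem_ball_iff_norm, sub_neg_eq_add] at hz
    filter_upwards [hb, self_mem_nhdsWithin] with z hz hz2 n
    have hNp := hpow N
    have hnp := hpow n
    by_cases h : n = N
    · subst h
      have hz' : z + ((n : ℕ) : ℂ) ^ p ≠ 0 := fun h0 => hz2 n (eq_neg_of_add_eq_zero_left h0)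
      rw [add_comm _ z, mul_one_div_cancel hz', mul_one_div_cancel (by linarith), norm_one]
    · have hs := hsep n h
      have ht : c / 2 * ((n : ℕ) : ℝ) ^ p.re ≤ ‖((n : ℕ) : ℂ) ^ p + z‖ := by
        have := norm_sub_norm_le (((n : ℕ) : ℂ) ^ p - ((N : ℕ) : ℂ) ^ p)
          (-(z + ((N : ℕ) : ℂ) ^ p))
        rw [norm_neg, show ((n : ℕ) : ℂ) ^ p - ((N : ℕ) : ℂ) ^ p - -(z + ((N : ℕ) : ℂ) ^ p)
          = ((n : ℕ) : ℂ) ^ p + z by ring] at this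
        nlinarith
      have hpos : 0 < c / 2 * ((n : ℕ) : ℝ) ^ p.re := by positivity
      rw [norm_mul, norm_div, norm_one]
      calc ‖z + ((N : ℕ) : ℂ) ^ p‖ * (1 / ‖((n : ℕ) : ℂ) ^ p + z‖)
          ≤ c / 2 * (1 / (c / 2 * ((n : ℕ) : ℝ) ^ p.re)) := by gcongr
        _ = 1 * (1 / ((n : ℕ) : ℝ) ^ p.re) := by field_simp
        _ ≤ _ := by gcongr
end

section
/- Let a : ℕ → ℂ with Dirichlet series f(s) = ∑_{n=1}^∞ a_n/n^s having abscissa of absolute convergence σ_a, and let s be a complex number with Re(s) > σ_a and Re(s) > 0. Then for every positive integer N, (z + N^s) · ∑_{n=1}^∞ a_n/(n^s + z) tends to a_N as z tends to -N^s through values z ≠ -n^s for all positive integers n. In other words, whenever a_N ≠ 0, the function z ↦ ∑_{n=1}^∞ a_n/(n^s + z) has a simple pole at z = -N^s with residue a_N. -/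
open Filter Topology

lemma gap_lemma (σ : ℝ) (hσ : 0 < σ) (N : ℕ+) :
    ∃ c : ℝ, 0 < c ∧ ∀ n : ℕ+, n ≠ N →
      c * ((n : ℕ) : ℝ) ^ σ ≤ |((n : ℕ) : ℝ) ^ σ - ((N : ℕ) : ℝ) ^ σ| := by
  have hN : (0 : ℝ) < ((N : ℕ) : ℝ) := by exact_mod_cast N.pos
  set r : ℝ := ((((N : ℕ) : ℝ) + 1) / ((N : ℕ) : ℝ)) ^ σ with hr
  have hr1 : 1 < r := by
    apply Real.one_lt_rpow _ hσ
    rw [lt_div_iff₀ hN]; linarith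
  have hr0 : 0 < r := by linarith
  refine ⟨1 - 1 / r, ?_, ?_⟩
  · have : 1 / r < 1 := by rw [div_lt_one hr0]; exact hr1
    linarith
  · intro n hn
    have hn0 : (0 : ℝ) < ((n : ℕ) : ℝ) := by exact_mod_cast n.pos
    have hp : 0 < ((n : ℕ) : ℝ) ^ σ := Real.rpow_pos_of_pos hn0 _
    have key : ∀ x y : ℝ, 0 < x → (((N : ℕ) : ℝ) + 1) * x ≤ y * ((N : ℕ) : ℝ) →
        r * x ^ σ ≤ y ^ σ := by
      intro x y hx hxy
      rw [hr, ← Real.mul_rpow (by positivity) hx.le]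
      apply Real.rpow_le_rpow (by positivity) _ hσ.le
      rw [div_mul_eq_mul_div, div_le_iff₀ hN]; exact hxy
    rcases lt_or_gt_of_ne hn with h | h
    · have h1 : ((n : ℕ) : ℝ) + 1 ≤ ((N : ℕ) : ℝ) := by exact_mod_cast h
      have h2 := key n N hn0 (by nlinarith)
      have h3 : 1 - 1 / r ≤ r - 1 := by
        have : r * (1 / r) = 1 := by field_simp
        have : 0 < 1 / r := by positivity
        nlinarith
      rw [abs_sub_comm]
      refine le_trans ?_ (le_abs_self _)
      nlinarith
    · have h1 : ((N : ℕ) : ℝ) + 1 ≤ ((n : ℕ) : ℝ) := by exact_mod_cast h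
      have h2 := key N n hN (by nlinarith)
      refine le_trans ?_ (le_abs_self _)
      have h3 : ((N : ℕ) : ℝ) ^ σ ≤ 1 / r * ((n : ℕ) : ℝ) ^ σ := by
        rw [div_mul_eq_mul_div, le_div_iff₀ hr0]; linarith
      linarith

/-- If the Dirichlet series `∑ aₙ/n^s` has abscissa of absolute convergence `σ_a`,
`Re s > σ_a`, `Re s > 0`, then `z ↦ ∑_{n=1}^∞ aₙ/(n^s + z)` has a simple pole at
`z = -N^s` with residue `a_N`: `(z + N^s) · ∑ₙ aₙ/(n^s + z) → a_N` as `z → -N^s`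
through values avoiding all `-n^s`. -/
theorem statement8 (a : ℕ → ℂ) (s : ℂ)
    (hs : LSeries.abscissaOfAbsConv a < (s.re : EReal)) (hs0 : 0 < s.re) (N : ℕ+) :
    Filter.Tendsto
      (fun z : ℂ => (z + ((N : ℕ) : ℂ) ^ s) * ∑' n : ℕ+, a n / (((n : ℕ) : ℂ) ^ s + z))
      (nhdsWithin (-((N : ℕ) : ℂ) ^ s) {z : ℂ | ∀ n : ℕ+, z ≠ -((n : ℕ) : ℂ) ^ s})
      (nhds (a N)) := by
  obtain ⟨c, hc, hgap⟩ := gap_lemma s.re hs0 N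
  have hsum : Summable (fun n : ℕ+ => ‖a n‖ / ((n : ℕ) : ℝ) ^ s.re) := by
    have h := (LSeriesSummable_of_abscissaOfAbsConv_lt_re hs).norm
    have h2 := h.comp_injective (i := fun n : ℕ+ => (n : ℕ)) PNat.coe_injective
    refine h2.congr fun n => ?_
    simp [LSeries.norm_term_eq]
  have hnorm : ∀ n : ℕ+, ‖((n : ℕ) : ℂ) ^ s‖ = ((n : ℕ) : ℝ) ^ s.re := fun n =>
    Complex.norm_natCast_cpow_of_pos n.pos s
  have hone : ∀ n : ℕ+, (1 : ℝ) ≤ ((n : ℕ) : ℝ) ^ s.re := fun n =>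
    Real.one_le_rpow (by exact_mod_cast n.pos) hs0.le
  have hdiff : ∀ n : ℕ+, n ≠ N →
      c * ((n : ℕ) : ℝ) ^ s.re ≤ ‖((n : ℕ) : ℂ) ^ s - ((N : ℕ) : ℂ) ^ s‖ := by
    intro n hn
    refine (hgap n hn).trans ?_
    rw [← hnorm, ← hnorm]
    exact abs_norm_sub_norm_le _ _
  have hlim : (∑' n : ℕ+, if n = N then a N else 0) = a N := tsum_ite_eq N _
  have hcont : Tendsto (fun z : ℂ => z + ((N : ℕ) : ℂ) ^ s)
      (nhdsWithin (-((N : ℕ) : ℂ) ^ s) {z : ℂ | ∀ n : ℕ+, z ≠ -((n : ℕ) : ℂ) ^ s}) (𝓝 0) := by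
    have : Tendsto (fun z : ℂ => z + ((N : ℕ) : ℂ) ^ s) (𝓝 (-((N : ℕ) : ℂ) ^ s))
      (𝓝 (-((N : ℕ) : ℂ) ^ s + ((N : ℕ) : ℂ) ^ s)) := tendsto_id.add_const _
    rw [neg_add_cancel] at this
    exact this.mono_left nhdsWithin_le_nhds
  have hne : ∀ z : ℂ, (∀ n : ℕ+, z ≠ -((n : ℕ) : ℂ) ^ s) →
      ∀ n : ℕ+, ((n : ℕ) : ℂ) ^ s + z ≠ 0 := fun z hz n h =>
    hz n (eq_neg_of_add_eq_zero_right h)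
  have heq : ∀ z : ℂ, (∀ n : ℕ+, z ≠ -((n : ℕ) : ℂ) ^ s) →
      (z + ((N : ℕ) : ℂ) ^ s) * (a N / (((N : ℕ) : ℂ) ^ s + z)) = a N := by
    intro z hz
    have := hne z hz N
    rw [add_comm z, mul_div_cancel₀ _ this]
  simp_rw [← tsum_mul_left]
  rw [← hlim]
  refine tendsto_tsum_of_dominated_convergence
    (bound := fun n : ℕ+ => ((N : ℕ) : ℝ) ^ s.re * (‖a n‖ / ((n : ℕ) : ℝ) ^ s.re))
    (hsum.mul_left _) ?_ ?_
  · intro n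
    by_cases hn : n = N
    · subst hn
      simp only [if_true]
      refine tendsto_const_nhds.congr' ?_
      filter_upwards [self_mem_nhdsWithin] with z hz
      exact (heq z hz).symm
    · simp only [hn, if_false]
      have hd : ((n : ℕ) : ℂ) ^ s + -((N : ℕ) : ℂ) ^ s ≠ 0 := by
        rw [← sub_eq_add_neg, ← norm_pos_iff]
        have := hdiff n hn
        have := hone n
        nlinarith
      have h1 : Tendsto (fun z : ℂ => a n / (((n : ℕ) : ℂ) ^ s + z))
          (𝓝 (-((N : ℕ) : ℂ) ^ s)) (𝓝 (a n / (((n : ℕ) : ℂ) ^ s + -((N : ℕ) : ℂ) ^ s))) :=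
        tendsto_const_nhds.div (tendsto_id.const_add _) hd
      simpa using hcont.mul (h1.mono_left nhdsWithin_le_nhds)
  · have hsmall := hcont.norm
    rw [norm_zero] at hsmall
    filter_upwards [self_mem_nhdsWithin, hsmall.eventually (gt_mem_nhds (half_pos hc))] with z hz hw n
    have hn1 := hone n
    have hN1 := hone N
    by_cases hn : n = N
    · subst hn
      rw [heq z hz, mul_div_cancel₀ _ (by linarith)]
    · have hd := hdiff n hn
      have h1 : c / 2 * ((n : ℕ) : ℝ) ^ s.re ≤ ‖((n : ℕ) : ℂ) ^ s + z‖ := by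
        have := norm_sub_le (((n : ℕ) : ℂ) ^ s + z) (z + ((N : ℕ) : ℂ) ^ s)
        rw [show ((n : ℕ) : ℂ) ^ s + z - (z + ((N : ℕ) : ℂ) ^ s)
          = ((n : ℕ) : ℂ) ^ s - ((N : ℕ) : ℂ) ^ s by ring] at this
        nlinarith
      rw [norm_mul, norm_div]
      have h2 : ‖a n‖ / ‖((n : ℕ) : ℂ) ^ s + z‖ ≤ ‖a n‖ / (c / 2 * ((n : ℕ) : ℝ) ^ s.re) :=
        div_le_div_of_nonneg_left (norm_nonneg _) (by positivity) h1
      have h3 : 0 ≤ ‖a n‖ / ((n : ℕ) : ℝ) ^ s.re := by positivity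
      calc _ ≤ c / 2 * (‖a n‖ / (c / 2 * ((n : ℕ) : ℝ) ^ s.re)) := by gcongr
        _ = ‖a n‖ / ((n : ℕ) : ℝ) ^ s.re := by field_simp
        _ ≤ _ := le_mul_of_one_le_left h3 hN1
end
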